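/- arXiv:q-alg/9509025 — 2 statements merged into one kernel-verified Lean document; each statement's English description precedes it below -/
import Mathlib

section
/- For r, μ ∈ ℂ, the sl₂(ℂ)-module E_{r,μ} is simple (i.e., has no subspaces invariant under the actions of e, f, h other than 0 and the whole space) if and only if μ ∉ ℤ and r - μ ∉ ℤ. -/
noncomputable section

/-- The underlying space of the module `E_{r,μ}`: finitely supported functions `ℤ → ℂ`,
with basis `{E_i : i ∈ ℤ}`. -/
abbrev EMod : Type := ℤ →₀ ℂ

/-- The basis vector `E_i`. -/
def Evec (i : ℤ) : EMod := Finsupp.single i 1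

/-- The action of `e` on `E_{r,μ}`: `e·E_i = -(μ+i)·E_{i-1}`. -/
def eOp (μ : ℂ) : Module.End ℂ EMod :=
  Finsupp.lsum ℂ fun i => LinearMap.toSpanSingleton ℂ EMod ((-(μ + (i : ℂ))) • Evec (i - 1))

/-- The action of `h` on `E_{r,μ}`: `h·E_i = (r - 2μ - 2i)·E_i`. -/
def hOp (r μ : ℂ) : Module.End ℂ EMod :=
  Finsupp.lsum ℂ fun i => LinearMap.toSpanSingleton ℂ EMod ((r - 2 * μ - 2 * (i : ℂ)) • Evec i)

/-- The action of `f` on `E_{r,μ}`: `f·E_i = (μ+i-r)·E_{i+1}`. -/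
def fOp (r μ : ℂ) : Module.End ℂ EMod :=
  Finsupp.lsum ℂ fun i => LinearMap.toSpanSingleton ℂ EMod ((μ + (i : ℂ) - r) • Evec (i + 1))

@[simp] theorem eOp_apply (μ : ℂ) (i : ℤ) :
    eOp μ (Evec i) = (-(μ + (i : ℂ))) • Evec (i - 1) := by
  rw [eOp, Evec]; rw [Finsupp.lsum_single]; simp [Evec]

@[simp] theorem hOp_apply (r μ : ℂ) (i : ℤ) :
    hOp r μ (Evec i) = (r - 2 * μ - 2 * (i : ℂ)) • Evec i := by
  rw [hOp, Evec]; rw [Finsupp.lsum_single]; simp [Evec]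

@[simp] theorem fOp_apply (r μ : ℂ) (i : ℤ) :
    fOp r μ (Evec i) = (μ + (i : ℂ) - r) • Evec (i + 1) := by
  rw [fOp, Evec]; rw [Finsupp.lsum_single]; simp [Evec]

theorem hOp_coeff (r μ : ℂ) (x : EMod) (j : ℤ) :
    hOp r μ x j = (r - 2 * μ - 2 * (j : ℂ)) * x j := by
  have h : Finsupp.lapply j ∘ₗ hOp r μ
      = (r - 2 * μ - 2 * (j : ℂ)) • (Finsupp.lapply j : EMod →ₗ[ℂ] ℂ) := by
    refine Finsupp.lhom_ext' fun i => LinearMap.ext_ring ?_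
    change hOp r μ (Evec i) j = (r - 2 * μ - 2 * (j : ℂ)) * Evec i j
    rw [hOp_apply, Finsupp.smul_apply, smul_eq_mul]
    by_cases hij : i = j
    · rw [hij]
    · simp [Evec, Finsupp.single_eq_of_ne' hij]
  exact LinearMap.congr_fun h x

/-- A nonzero subspace invariant under `h` contains one of the weight vectors `E_i`. -/
theorem exists_Evec_mem_of_hOp_invariant (r μ : ℂ) (W : Submodule ℂ EMod)
    (hW : ∀ x ∈ W, hOp r μ x ∈ W) (x : EMod) (hx : x ∈ W) (hx0 : x ≠ 0) :
    ∃ i, Evec i ∈ W := by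
  induction hn : x.support.card using Nat.strong_induction_on generalizing x with
  | _ n ih =>
    obtain ⟨j, hj⟩ := Finsupp.support_nonempty_iff.mpr hx0
    have hxj : x j ≠ 0 := Finsupp.mem_support_iff.mp hj
    set y : EMod := hOp r μ x - (r - 2 * μ - 2 * (j : ℂ)) • x with hy
    have hyW : y ∈ W := W.sub_mem (hW x hx) (W.smul_mem _ hx)
    have hyk (k : ℤ) : y k = 2 * ((j : ℂ) - k) * x k := by
      rw [hy, Finsupp.sub_apply, Finsupp.smul_apply, hOp_coeff, smul_eq_mul]
      ring
    by_cases hy0 : y = 0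
    · refine ⟨j, ?_⟩
      have hE : Evec j = (x j)⁻¹ • x := by
        ext k
        by_cases hk : j = k
        · subst hk
          simp [Evec, hxj]
        · have h := hyk k
          have hjk : (j : ℂ) - k ≠ 0 := sub_ne_zero.mpr (by exact_mod_cast hk)
          rw [hy0, Finsupp.zero_apply, eq_comm] at h
          have hxk : x k = 0 := by simpa [hjk] using h
          simp [Evec, hxk, Finsupp.single_eq_of_ne' hk]
      rw [hE]
      exact W.smul_mem _ hx
    · refine ih y.support.card ?_ y hyW hy0 rfl
      rw [← hn]
      refine Finset.card_lt_card ((Finset.ssubset_iff_of_subset fun k hk => ?_).mpr ⟨j, hj, ?_⟩)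
      · rw [Finsupp.mem_support_iff, hyk] at hk
        exact Finsupp.mem_support_iff.mpr (right_ne_zero_of_mul hk)
      · simp [hyk]

theorem eq_top_of_forall_Evec_mem (W : Submodule ℂ EMod) (h : ∀ i, Evec i ∈ W) : W = ⊤ := by
  rw [eq_top_iff, ← Finsupp.supported_univ, Finsupp.supported_eq_span_single, Submodule.span_le]
  rintro _ ⟨i, -, rfl⟩
  exact h i

theorem map_mem_supported (T : Module.End ℂ EMod) (s : Set ℤ)
    (h : ∀ i ∈ s, T (Evec i) ∈ Finsupp.supported ℂ ℂ s) (x : EMod)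
    (hx : x ∈ Finsupp.supported ℂ ℂ s) : T x ∈ Finsupp.supported ℂ ℂ s := by
  suffices Finsupp.supported ℂ ℂ s ≤ (Finsupp.supported ℂ ℂ s).comap T from this hx
  conv_lhs => rw [Finsupp.supported_eq_span_single]
  rw [Submodule.span_le]
  rintro _ ⟨i, hi, rfl⟩
  exact h i hi

theorem Evec_mem_supported_iff {s : Set ℤ} {i : ℤ} :
    Evec i ∈ Finsupp.supported ℂ ℂ s ↔ i ∈ s := by
  simp [Finsupp.mem_supported, Evec]

theorem smul_Evec_mem_supported {s : Set ℤ} {i : ℤ} {c : ℂ} (h : c = 0 ∨ i ∈ s) :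
    c • Evec i ∈ Finsupp.supported ℂ ℂ s := by
  rcases h with rfl | h
  · simp
  · exact Submodule.smul_mem _ _ (Evec_mem_supported_iff.mpr h)

/-- A nonempty proper set of weights closed under the nonzero transitions of `e` and `f` spans a
nontrivial invariant subspace. -/
theorem exists_invariant_of_set (r μ : ℂ) (s : Set ℤ) {a b : ℤ} (ha : a ∈ s) (hb : b ∉ s)
    (he : ∀ i ∈ s, -(μ + (i : ℂ)) = 0 ∨ i - 1 ∈ s)
    (hf : ∀ i ∈ s, μ + (i : ℂ) - r = 0 ∨ i + 1 ∈ s) :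
    ∃ W : Submodule ℂ EMod, (∀ x ∈ W, eOp μ x ∈ W) ∧ (∀ x ∈ W, fOp r μ x ∈ W) ∧
      (∀ x ∈ W, hOp r μ x ∈ W) ∧ W ≠ ⊥ ∧ W ≠ ⊤ := by
  refine ⟨Finsupp.supported ℂ ℂ s, map_mem_supported _ s fun i hi => ?_,
    map_mem_supported _ s fun i hi => ?_, map_mem_supported _ s fun i hi => ?_, ?_, ?_⟩
  · rw [eOp_apply]
    exact smul_Evec_mem_supported (he i hi)
  · rw [fOp_apply]
    exact smul_Evec_mem_supported (hf i hi)
  · rw [hOp_apply]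
    exact smul_Evec_mem_supported (Or.inr hi)
  · intro h
    have h0 := Evec_mem_supported_iff.mpr ha
    rw [h, Submodule.mem_bot] at h0
    simp [Evec] at h0
  · intro h
    exact hb (Evec_mem_supported_iff.mp (h ▸ Submodule.mem_top))

/-- For `r, μ ∈ ℂ`, the `sl₂(ℂ)`-module `E_{r,μ}` is simple (i.e. has no
subspaces invariant under `e`, `f`, `h` other than `0` and the whole space) if and only if
`μ ∉ ℤ` and `r - μ ∉ ℤ`. -/
theorem Emod_simple_iff (r μ : ℂ) :
    (∀ W : Submodule ℂ EMod,
        (∀ x ∈ W, eOp μ x ∈ W) → (∀ x ∈ W, fOp r μ x ∈ W) → (∀ x ∈ W, hOp r μ x ∈ W) →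
        W = ⊥ ∨ W = ⊤)
      ↔ ((∀ n : ℤ, μ ≠ (n : ℂ)) ∧ (∀ n : ℤ, r - μ ≠ (n : ℂ))) := by
  constructor
  · intro h
    constructor
    · rintro n rfl
      obtain ⟨W, he, hf, hh, hbot, htop⟩ := exists_invariant_of_set r n (Set.Ici (-n))
        (a := -n) (b := -n - 1) (by simp) (by simp)
        (fun i hi => by
          rcases (Set.mem_Ici.mp hi).eq_or_lt with rfl | hi
          · left
            simp
          · right
            simp only [Set.mem_Ici]
            omega)
        (fun i hi => Or.inr (by simp only [Set.mem_Ici] at hi ⊢; omega))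
      exact (h W he hf hh).elim hbot htop
    · intro n hn
      obtain ⟨W, he, hf, hh, hbot, htop⟩ := exists_invariant_of_set r μ (Set.Iic n)
        (a := n) (b := n + 1) (by simp) (by simp)
        (fun i hi => Or.inr (by simp only [Set.mem_Iic] at hi ⊢; omega))
        (fun i hi => by
          rcases (Set.mem_Iic.mp hi).eq_or_lt with rfl | hi
          · left
            linear_combination -hn
          · right
            simp only [Set.mem_Iic]
            omega)
      exact (h W he hf hh).elim hbot htop
  · rintro ⟨hμ, hr⟩ W he hf hh
    refine or_iff_not_imp_left.mpr fun hW => ?_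
    obtain ⟨x, hx, hx0⟩ := W.ne_bot_iff.mp hW
    obtain ⟨i, hi⟩ := exists_Evec_mem_of_hOp_invariant r μ W hh x hx hx0
    refine eq_top_of_forall_Evec_mem W fun j => ?_
    induction j using Int.inductionOn' (b := i) with
    | zero => exact hi
    | succ k _ hk =>
      have h := hf _ hk
      rw [fOp_apply] at h
      refine (W.smul_mem_iff fun h0 => hr k ?_).mp h
      linear_combination -h0
    | pred k _ hk =>
      have h := he _ hk
      rw [eOp_apply] at h
      refine (W.smul_mem_iff fun h0 => hμ (-k) ?_).mp h
      push_cast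
      linear_combination -h0
end
end

section
/- Let r ∈ ℂ and consider the module E_{r,0} (the case μ = 0). Then the subspace E⁺ spanned by {E_i : i ≥ 0} is invariant under the actions of e, f and h; the vector E_0 satisfies e·E_0 = 0 and h·E_0 = r·E_0; and if moreover r ∉ ℤ≥0, then the vectors f^i·E_0 (i ∈ ℤ≥0) form a basis of E⁺, so that E⁺ is a highest weight sl₂(ℂ)-module with highest weight r on which f acts injectively (a Verma module M(rω)). -/
noncomputable section

/-- The subspace `E⁺` of `E_{r,0}` spanned by the `E_i` with `i ≥ 0`. -/
def Eplus : Submodule ℂ EMod :=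
  Submodule.span ℂ {v : EMod | ∃ i : ℤ, 0 ≤ i ∧ v = Evec i}

theorem Evec_mem_Eplus {i : ℤ} (hi : 0 ≤ i) : Evec i ∈ Eplus :=
  Submodule.subset_span ⟨i, hi, rfl⟩

/-- An endomorphism preserves `E⁺` as soon as it maps the spanning vectors into `E⁺`. -/
theorem map_mem_Eplus (T : Module.End ℂ EMod) (hT : ∀ i : ℤ, 0 ≤ i → T (Evec i) ∈ Eplus) :
    ∀ x ∈ Eplus, T x ∈ Eplus := by
  have h : Eplus ≤ Eplus.comap T := by
    refine Submodule.span_le.2 ?_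
    rintro _ ⟨i, hi, rfl⟩
    exact hT i hi
  exact h

theorem eOp_zero_Evec_mem_Eplus {i : ℤ} (hi : 0 ≤ i) : eOp 0 (Evec i) ∈ Eplus := by
  rw [eOp_apply]
  rcases hi.eq_or_lt with rfl | hi
  · simp
  · exact Submodule.smul_mem _ _ (Evec_mem_Eplus (by omega))

theorem apply_eq_zero_of_mem_Eplus {x : EMod} (hx : x ∈ Eplus) {i : ℤ} (hi : i < 0) :
    x i = 0 := by
  have h : Eplus ≤ LinearMap.ker (Finsupp.lapply i : EMod →ₗ[ℂ] ℂ) := by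
    refine Submodule.span_le.2 ?_
    rintro _ ⟨j, hj, rfl⟩
    simp [Evec, show j ≠ i by omega]
  exact h hx

theorem fOp_coeff_succ (r μ : ℂ) (x : EMod) (i : ℤ) :
    fOp r μ x (i + 1) = (μ + (i : ℂ) - r) * x i := by
  induction x using Finsupp.induction_linear with
  | zero => simp
  | add x y hx hy => rw [(fOp r μ).map_add, Finsupp.add_apply, hx, hy, Finsupp.add_apply, mul_add]
  | single j c =>
    have h : Finsupp.single j c = c • Evec j := by simp [Evec]
    rw [h, map_smul, fOp_apply]
    by_cases hji : j = i
    · subst hji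
      simp [Evec, mul_comm]
    · simp [Evec, hji]

theorem fOp_pow_Evec_zero (r μ : ℂ) (n : ℕ) :
    (fOp r μ ^ n) (Evec 0) = (∏ j ∈ Finset.range n, (μ + (j : ℂ) - r)) • Evec n := by
  induction n with
  | zero => simp
  | succ n ih =>
    rw [pow_succ', Module.End.mul_apply, ih, map_smul, fOp_apply, smul_smul,
      Finset.prod_range_succ]
    simp

theorem linearIndependent_Evec_natCast : LinearIndependent ℂ fun n : ℕ => Evec n :=
  (Finsupp.linearIndependent_single_one ℂ ℤ).comp (fun n : ℕ => (n : ℤ)) Nat.cast_injective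

theorem span_range_Evec_natCast :
    Submodule.span ℂ (Set.range fun n : ℕ => Evec n) = Eplus := by
  rw [Eplus]
  congr 1
  ext v
  constructor
  · rintro ⟨n, rfl⟩
    exact ⟨n, n.cast_nonneg, rfl⟩
  · rintro ⟨i, hi, rfl⟩
    exact ⟨i.toNat, by simp [hi]⟩

/-- For `r ∈ ℂ` and `μ = 0`: the subspace `E⁺` spanned by
`{E_i : i ≥ 0}` is invariant under `e`, `f`, `h`; the vector `E_0` satisfies `e·E_0 = 0`
and `h·E_0 = r·E_0`; and if `r ∉ ℤ≥0`, then the vectors `f^i·E_0` (`i ∈ ℤ≥0`) form a basis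
of `E⁺` (they are linearly independent and span `E⁺`), so that `E⁺` is a highest weight
`sl₂(ℂ)`-module with highest weight `r` on which `f` acts injectively
(a Verma module `M(rω)`). -/
theorem Eplus_verma (r : ℂ) :
    (∀ x ∈ Eplus, eOp 0 x ∈ Eplus) ∧
    (∀ x ∈ Eplus, fOp r 0 x ∈ Eplus) ∧
    (∀ x ∈ Eplus, hOp r 0 x ∈ Eplus) ∧
    eOp 0 (Evec 0) = 0 ∧
    hOp r 0 (Evec 0) = r • Evec 0 ∧
    ((∀ n : ℕ, r ≠ (n : ℂ)) →
      LinearIndependent ℂ (fun i : ℕ => (fOp r 0 ^ i) (Evec 0)) ∧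
      Submodule.span ℂ (Set.range fun i : ℕ => (fOp r 0 ^ i) (Evec 0)) = Eplus ∧
      ∀ x ∈ Eplus, fOp r 0 x = 0 → x = 0) := by
  refine ⟨map_mem_Eplus _ fun i hi => eOp_zero_Evec_mem_Eplus hi,
    map_mem_Eplus _ fun i hi => ?_, map_mem_Eplus _ fun i hi => ?_, by simp, by simp,
    fun hr => ?_⟩
  · rw [fOp_apply]
    exact Submodule.smul_mem _ _ (Evec_mem_Eplus (by omega))
  · rw [hOp_apply]
    exact Submodule.smul_mem _ _ (Evec_mem_Eplus hi)
  have hne (n : ℕ) : (0 : ℂ) + (n : ℂ) - r ≠ 0 := by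
    rw [zero_add]
    exact sub_ne_zero.2 (hr n).symm
  have hprod (n : ℕ) : ∏ j ∈ Finset.range n, ((0 : ℂ) + (j : ℂ) - r) ≠ 0 :=
    Finset.prod_ne_zero_iff.2 fun j _ => hne j
  let w (n : ℕ) : ℂˣ := Units.mk0 _ (hprod n)
  have hpow : (fun n : ℕ => (fOp r 0 ^ n) (Evec 0)) = w • fun n : ℕ => Evec n :=
    funext fun n => fOp_pow_Evec_zero r 0 n
  refine ⟨?_, ?_, fun x hx hfx => ?_⟩
  · rw [hpow]
    exact linearIndependent_Evec_natCast.units_smul w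
  · rw [hpow, ← span_range_Evec_natCast]
    refine le_antisymm (Submodule.span_le.2 ?_) (Submodule.span_le.2 ?_)
    · rintro _ ⟨n, rfl⟩
      exact Submodule.smul_mem _ (w n : ℂ) (Submodule.subset_span ⟨n, rfl⟩)
    · rintro _ ⟨n, rfl⟩
      have h := Submodule.smul_mem _ ((w n)⁻¹ : ℂˣ).val
        (Submodule.subset_span (R := ℂ) (Set.mem_range_self (f := w • fun n : ℕ => Evec n) n))
      have hw : ((w n)⁻¹ : ℂˣ).val • (w • fun n : ℕ => Evec n) n = Evec n :=
        inv_smul_smul (w n) (Evec n)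
      rwa [hw] at h
  · ext i
    rcases lt_or_ge i 0 with hi | hi
    · exact apply_eq_zero_of_mem_Eplus hx hi
    · lift i to ℕ using hi
      have h := fOp_coeff_succ r 0 x i
      rw [hfx, Finsupp.zero_apply, Int.cast_natCast] at h
      exact (mul_eq_zero.1 h.symm).resolve_left (hne i)
end
end
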